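/- arXiv:2007.07304 — 6 statements merged into one kernel-verified Lean document; each statement's English description precedes it below -/
import Mathlib

section
/- Let k₁, k₂ > 0. For every M₀ > 0, E₀ ≥ 0, S₀ ∈ ℝ and L > 0 there exist constants θ̲ > 0 and V₀ > 0, depending only on k₁, k₂, M₀, E₀, S₀ and L, with the following property: for every measure space (Ω, μ) with μ(Ω) ≤ L and all measurable functions ρ, θ : Ω → ℝ with ρ ≥ 0 and θ > 0 almost everywhere, such that ρ, ρ·θ and s(ρ,θ) := −ρ(k₂ log ρ − k₁(log θ + 1)) are μ-integrable and ∫ ρ dμ = M₀, ∫ ρθ dμ ≤ E₀, and ∫ s(ρ,θ) dμ ≥ S₀, one has μ({x ∈ Ω : θ(x) > θ̲}) ≥ V₀. -/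
open Real MeasureTheory

/-- The concave function `r ↦ -(r log r)` lies below its tangent line at `b`. -/
lemma neg_mul_log_le_tangent {r b : ℝ} (hr : 0 ≤ r) (hb : 0 < b) :
    -(r * Real.log r) ≤ b - r * (1 + Real.log b) := by
  rcases hr.eq_or_lt with rfl | hr
  · simpa using hb.le
  · have h := Real.log_le_sub_one_of_pos (div_pos hb hr)
    rw [Real.log_div hb.ne' hr.ne'] at h
    have h' := mul_le_mul_of_nonneg_left h hr.le
    have e : r * (b / r - 1) = b - r := by field_simp
    rw [e] at h'
    linarith

/-- The ideal-gas entropy is bounded by `k₁ r t - N r` up to a constant, which is small where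
the temperature is low. -/
lemma idealGas_entropy_le {k₁ k₂ r t : ℝ} (N : ℝ) (hk₁ : 0 < k₁) (hk₂ : 0 < k₂)
    (hr : 0 ≤ r) (ht : 0 < t) :
    -(r * (k₂ * Real.log r - k₁ * (Real.log t + 1))) ≤
      k₂ * (if Real.exp (-N / k₁ - 1) < t then Real.exp (N / k₂ - 1) else 0) + k₂
        + k₁ * (r * t) - N * r := by
  have hrt : 0 ≤ k₁ * (r * t) := by positivity
  split_ifs with h
  · have h1 := mul_le_mul_of_nonneg_left
      (neg_mul_log_le_tangent hr (Real.exp_pos (N / k₂ - 1))) hk₂.le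
    rw [Real.log_exp] at h1
    have e : k₂ * (Real.exp (N / k₂ - 1) - r * (1 + (N / k₂ - 1)))
        = k₂ * Real.exp (N / k₂ - 1) - N * r := by field_simp; ring
    have h2 := mul_le_mul_of_nonneg_left (Real.log_le_sub_one_of_pos ht) (mul_nonneg hk₁.le hr)
    linarith
  · have h1 := mul_le_mul_of_nonneg_left (neg_mul_log_le_tangent hr one_pos) hk₂.le
    rw [Real.log_one] at h1
    have hlog := (Real.log_le_iff_le_exp ht).2 (not_lt.1 h)
    have h2 := mul_le_mul_of_nonneg_left hlog (mul_nonneg hk₁.le hr)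
    have e : k₁ * r * (-N / k₁ - 1) = -(N * r) - k₁ * r := by field_simp
    have h3 : 0 ≤ k₂ * r := by positivity
    linarith

/-- Lemma 3.1 of the paper: positivity of the absolute temperature on a set of
positive measure. For `k₁, k₂ > 0` and data `M₀ > 0`, `E₀ ≥ 0`, `S₀ ∈ ℝ`, `L > 0`, there are
`θ̲ > 0` and `V₀ > 0` such that on any measure space of total measure at most `L`, any
nonnegative integrable `ρ` and positive `θ` with `∫ρ = M₀`, `∫ρθ ≤ E₀` and entropy
`∫ −ρ(k₂ log ρ − k₁(log θ + 1)) ≥ S₀` satisfy `μ{θ > θ̲} ≥ V₀`. -/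
theorem temperature_positive_on_large_set (k₁ k₂ : ℝ) (hk₁ : 0 < k₁) (hk₂ : 0 < k₂)
    (M₀ E₀ S₀ L : ℝ) (hM₀ : 0 < M₀) (hE₀ : 0 ≤ E₀) (hL : 0 < L) :
    ∃ θmin > (0:ℝ), ∃ V₀ > (0:ℝ),
      ∀ (Ω : Type) [MeasurableSpace Ω] (μ : Measure Ω),
        μ Set.univ ≤ ENNReal.ofReal L →
        ∀ ρ θ : Ω → ℝ, Measurable ρ → Measurable θ →
          (∀ᵐ x ∂μ, 0 ≤ ρ x) → (∀ᵐ x ∂μ, 0 < θ x) →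
          Integrable ρ μ →
          Integrable (fun x => ρ x * θ x) μ →
          Integrable (fun x => -(ρ x * (k₂ * Real.log (ρ x) - k₁ * (Real.log (θ x) + 1)))) μ →
          (∫ x, ρ x ∂μ) = M₀ →
          (∫ x, ρ x * θ x ∂μ) ≤ E₀ →
          S₀ ≤ (∫ x, -(ρ x * (k₂ * Real.log (ρ x) - k₁ * (Real.log (θ x) + 1))) ∂μ) →
          ENNReal.ofReal V₀ ≤ μ {x | θmin < θ x} := by
  obtain ⟨N, hN⟩ : ∃ N : ℝ, k₂ * (1 + L) + k₁ * E₀ - N * M₀ < S₀ :=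
    ⟨(k₂ * (1 + L) + k₁ * E₀ - S₀ + 1) / M₀, by rw [div_mul_cancel₀ _ hM₀.ne']; linarith⟩
  set b := Real.exp (N / k₂ - 1) with hb
  set τ := Real.exp (-N / k₁ - 1) with hτ
  have hb0 : 0 < b := Real.exp_pos _
  refine ⟨τ, Real.exp_pos _, b⁻¹, inv_pos.2 hb0, ?_⟩
  intro Ω _ μ hμ ρ θ _ hθ hρ0 hθ0 hρi hρθi hsi hM hE hS
  by_contra! hlt
  have : IsFiniteMeasure μ := ⟨hμ.trans_lt ENNReal.ofReal_lt_top⟩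
  set A := {x | τ < θ x} with hA
  have hAm : MeasurableSet A := measurableSet_lt measurable_const hθ
  have hAb : μ.real A ≤ b⁻¹ := ENNReal.toReal_le_of_le_ofReal (inv_pos.2 hb0).le hlt.le
  have huniv : μ.real Set.univ ≤ L := ENNReal.toReal_le_of_le_ofReal hL.le hμ
  have hint : Integrable (A.indicator fun _ => b) μ := (integrable_const b).indicator hAm
  have i1 : Integrable (fun x => k₂ * A.indicator (fun _ => b) x) μ := hint.const_mul k₂
  have i2 : Integrable (fun x => k₂ * A.indicator (fun _ => b) x + k₂) μ :=
    i1.add (integrable_const k₂)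
  have i3 : Integrable (fun x => k₁ * (ρ x * θ x)) μ := hρθi.const_mul k₁
  have i4 : Integrable (fun x => N * ρ x) μ := hρi.const_mul N
  have i5 : Integrable
      (fun x => k₂ * A.indicator (fun _ => b) x + k₂ + k₁ * (ρ x * θ x)) μ := i2.add i3
  have hle : (∫ x, -(ρ x * (k₂ * Real.log (ρ x) - k₁ * (Real.log (θ x) + 1))) ∂μ) ≤
      ∫ x, (k₂ * A.indicator (fun _ => b) x + k₂ + k₁ * (ρ x * θ x) - N * ρ x) ∂μ := by
    refine integral_mono_ae hsi (i5.sub i4) ?_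
    filter_upwards [hρ0, hθ0] with x hρx hθx
    simpa only [Set.indicator_apply, hA, Set.mem_ofPred_eq] using
      idealGas_entropy_le N hk₁ hk₂ hρx hθx
  rw [integral_sub i5 i4, integral_add i2 i3, integral_add i1 (integrable_const k₂),
    integral_const_mul, integral_const_mul, integral_const_mul, integral_indicator_const b hAm,
    integral_const, hM, smul_eq_mul, smul_eq_mul] at hle
  have h1 : μ.real A * b ≤ 1 := by
    calc μ.real A * b ≤ b⁻¹ * b := by gcongr
      _ = 1 := inv_mul_cancel₀ hb0.ne'
  have h2 := mul_le_mul_of_nonneg_left h1 hk₂.le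
  have h3 := mul_le_mul_of_nonneg_right huniv hk₂.le
  have h4 := mul_le_mul_of_nonneg_left hE hk₁.le
  linarith
end

section
/- Let Ω ⊆ ℝⁿ be a nonempty bounded convex open set and let V₀ > 0. Then there exists a constant C > 0 such that for every measurable set V ⊆ Ω with Lebesgue measure |V| ≥ V₀ and every continuously differentiable function v : ℝⁿ → ℝ, one has (∫_Ω (v(x)² + |∇v(x)|²) dx)^{1/2} ≤ C·((∫_Ω |∇v(x)|² dx)^{1/2} + ∫_V |v(x)| dx). -/
open Real MeasureTheory

open scoped ENNReal

theorem ENNReal.add_sq_le_two_mul (a b : ℝ≥0∞) : (a + b) ^ 2 ≤ 2 * (a ^ 2 + b ^ 2) := by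
  have h := ENNReal.rpow_add_le_mul_rpow_add_rpow a b (p := 2) (by norm_num)
  norm_num at h
  exact h

theorem MeasureTheory.sq_lintegral_le {α : Type*} [MeasurableSpace α] (μ : Measure α)
    {f : α → ℝ≥0∞} (hf : AEMeasurable f μ) :
    (∫⁻ x, f x ∂μ) ^ 2 ≤ μ Set.univ * ∫⁻ x, f x ^ 2 ∂μ := by
  have h := ENNReal.lintegral_mul_le_Lp_mul_Lq μ Real.HolderConjugate.two_two
    (aemeasurable_const (b := (1 : ℝ≥0∞))) hf
  have h2 := pow_le_pow_left' h 2
  rw [mul_pow, ← ENNReal.rpow_natCast, ← ENNReal.rpow_natCast, ← ENNReal.rpow_natCast,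
    ← ENNReal.rpow_mul, ← ENNReal.rpow_mul] at h2
  simpa using h2

section Haar

variable {E : Type*} [NormedAddCommGroup E] [NormedSpace ℝ E] [FiniteDimensional ℝ E]
  [MeasurableSpace E] [BorelSpace E] (μ : Measure E) [μ.IsAddHaarMeasure]

theorem lintegral_comp_smul_add_le {h : E → ℝ≥0∞} (hh : Measurable h) {s : ℝ}
    (hs : 1 / 2 ≤ s) (w : E) :
    ∫⁻ x, h (s • x + w) ∂μ ≤ 2 ^ Module.finrank ℝ E * ∫⁻ x, h x ∂μ := by
  have hs0 : 0 < s := by linarith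
  have hmap := lintegral_map (μ := μ) (f := fun x => h (x + w)) (g := fun x => s • x)
    (by fun_prop) (by fun_prop)
  rw [← hmap, Measure.map_addHaar_smul μ hs0.ne', lintegral_smul_measure,
    lintegral_add_right_eq_self h w, smul_eq_mul]
  gcongr
  rw [abs_of_pos (by positivity), ← inv_pow, ENNReal.ofReal_pow (by positivity)]
  gcongr
  rw [← ENNReal.ofReal_ofNat 2]
  apply ENNReal.ofReal_le_ofReal
  rw [inv_le_comm₀ hs0 (by norm_num)]
  linarith

theorem setLIntegral_comp_smul_add_le {h : E → ℝ≥0∞} (hh : Measurable h) {Ω : Set E}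
    (hΩ : MeasurableSet Ω) {s : ℝ} (hs : 1 / 2 ≤ s) {w : E}
    (hw : ∀ x ∈ Ω, s • x + w ∈ Ω) :
    ∫⁻ x in Ω, h (s • x + w) ∂μ ≤ 2 ^ Module.finrank ℝ E * ∫⁻ x in Ω, h x ∂μ := by
  rw [← lintegral_indicator hΩ h]
  refine le_trans ?_ (lintegral_comp_smul_add_le μ (hh.indicator hΩ) hs w)
  rw [← lintegral_indicator hΩ]
  refine lintegral_mono fun x => ?_
  by_cases hx : x ∈ Ω
  · simp [hx, hw x hx]
  · simp [hx]

theorem lintegral_lintegral_segment_le {h : E → ℝ≥0∞} (hh : Measurable h) {Ω : Set E}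
    (hΩ : MeasurableSet Ω) (hc : Convex ℝ Ω) {t : ℝ} (ht : t ∈ Set.Icc (0 : ℝ) 1) :
    ∫⁻ x in Ω, ∫⁻ y in Ω, h ((1 - t) • x + t • y) ∂μ ∂μ ≤
      2 ^ Module.finrank ℝ E * μ Ω * ∫⁻ x in Ω, h x ∂μ := by
  have key : ∀ s ∈ Set.Icc (1 / 2 : ℝ) 1,
      ∫⁻ y in Ω, ∫⁻ x in Ω, h (s • x + (1 - s) • y) ∂μ ∂μ ≤
        2 ^ Module.finrank ℝ E * μ Ω * ∫⁻ x in Ω, h x ∂μ := by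
    intro s hs
    calc ∫⁻ y in Ω, ∫⁻ x in Ω, h (s • x + (1 - s) • y) ∂μ ∂μ
        ≤ ∫⁻ y in Ω, 2 ^ Module.finrank ℝ E * ∫⁻ x in Ω, h x ∂μ ∂μ :=
          setLIntegral_mono' hΩ fun y hy => setLIntegral_comp_smul_add_le μ hh hΩ hs.1
            fun x hx => hc hx hy (by linarith [hs.1]) (by linarith [hs.2]) (by ring)
      _ = _ := by rw [setLIntegral_const]; ring
  rcases le_total t (1 / 2) with h2 | h2
  · rw [lintegral_lintegral_swap (by fun_prop)]
    simpa using key (1 - t) ⟨by linarith, by linarith [ht.1]⟩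
  · simpa only [add_comm] using key t ⟨h2, ht.2⟩

end Haar

section Poincare

variable {E : Type*} [NormedAddCommGroup E] [NormedSpace ℝ E]

theorem enorm_sub_sq_le_lintegral_fderiv {v : E → ℝ} (hv : ContDiff ℝ 1 v) (x y : E) :
    ‖v y - v x‖ₑ ^ 2 ≤ ‖y - x‖ₑ ^ 2 *
      ∫⁻ t in Set.Ioc (0 : ℝ) 1, ‖fderiv ℝ v ((1 - t) • x + t • y)‖ₑ ^ 2 := by
  have hcont : Continuous fun t : ℝ => fderiv ℝ v ((1 - t) • x + t • y) :=
    (hv.continuous_fderiv one_ne_zero).comp (by fun_prop)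
  have hderiv : ∀ t : ℝ, HasDerivAt (fun t : ℝ => v ((1 - t) • x + t • y))
      (fderiv ℝ v ((1 - t) • x + t • y) (y - x)) t := by
    intro t
    have hl : HasDerivAt (fun t : ℝ => (1 - t) • x + t • y) (y - x) t := by
      have h := (((hasDerivAt_id t).const_sub 1).smul_const x).add
        ((hasDerivAt_id t).smul_const y)
      rwa [neg_one_smul, one_smul, neg_add_eq_sub] at h
    exact ((hv.differentiable one_ne_zero _).hasFDerivAt).comp_hasDerivAt t hl
  have hftc := intervalIntegral.integral_eq_sub_of_hasDerivAt (a := 0) (b := 1)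
    (fun t _ => hderiv t) ((hcont.clm_apply continuous_const).intervalIntegrable _ _)
  rw [intervalIntegral.integral_of_le zero_le_one] at hftc
  simp only [sub_self, zero_smul, one_smul, zero_add, sub_zero, add_zero] at hftc
  have hle : ‖v y - v x‖ₑ ≤
      ‖y - x‖ₑ * ∫⁻ t in Set.Ioc (0 : ℝ) 1, ‖fderiv ℝ v ((1 - t) • x + t • y)‖ₑ := by
    rw [← hftc, ← lintegral_const_mul' _ _ enorm_ne_top]
    refine (enorm_integral_le_lintegral_enorm _).trans (lintegral_mono fun t => ?_)
    rw [mul_comm]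
    exact ContinuousLinearMap.le_opENorm _ _
  refine (pow_le_pow_left' hle 2).trans ?_
  rw [mul_pow]
  gcongr
  simpa using sq_lintegral_le (volume.restrict (Set.Ioc (0 : ℝ) 1))
    hcont.enorm.measurable.aemeasurable

variable [FiniteDimensional ℝ E] [MeasurableSpace E] [BorelSpace E]
  (μ : Measure E) [μ.IsAddHaarMeasure]

theorem lintegral_lintegral_enorm_sub_sq_le {Ω : Set E} (hΩ : MeasurableSet Ω)
    (hc : Convex ℝ Ω) {v : E → ℝ} (hv : ContDiff ℝ 1 v) :
    ∫⁻ x in Ω, ∫⁻ y in Ω, ‖v y - v x‖ₑ ^ 2 ∂μ ∂μ ≤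
      Metric.ediam Ω ^ 2 * (2 ^ Module.finrank ℝ E * μ Ω) *
        ∫⁻ x in Ω, ‖fderiv ℝ v x‖ₑ ^ 2 ∂μ := by
  have hcont : Continuous fun x => ‖fderiv ℝ v x‖ₑ ^ 2 :=
    (ENNReal.continuous_pow 2).comp (hv.continuous_fderiv one_ne_zero).enorm
  set g : E → ℝ≥0∞ := fun x => ‖fderiv ℝ v x‖ₑ ^ 2
  have hgm : Measurable g := hcont.measurable
  calc ∫⁻ x in Ω, ∫⁻ y in Ω, ‖v y - v x‖ₑ ^ 2 ∂μ ∂μ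
      ≤ ∫⁻ x in Ω, ∫⁻ y in Ω, Metric.ediam Ω ^ 2 *
          ∫⁻ t in Set.Ioc (0 : ℝ) 1, g ((1 - t) • x + t • y) ∂volume ∂μ ∂μ := by
        refine setLIntegral_mono' hΩ fun x hx => setLIntegral_mono' hΩ fun y hy => ?_
        refine (enorm_sub_sq_le_lintegral_fderiv hv x y).trans ?_
        gcongr
        rw [← edist_eq_enorm_sub]
        exact Metric.edist_le_ediam_of_mem hy hx
    _ = Metric.ediam Ω ^ 2 * ∫⁻ t in Set.Ioc (0 : ℝ) 1, ∫⁻ x in Ω, ∫⁻ y in Ω,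
          g ((1 - t) • x + t • y) ∂μ ∂μ := by
        have h1 : ∀ x, ∫⁻ y in Ω, Metric.ediam Ω ^ 2 *
            ∫⁻ t in Set.Ioc (0 : ℝ) 1, g ((1 - t) • x + t • y) ∂volume ∂μ =
            Metric.ediam Ω ^ 2 * ∫⁻ t in Set.Ioc (0 : ℝ) 1, ∫⁻ y in Ω,
              g ((1 - t) • x + t • y) ∂μ := fun x => by
          rw [lintegral_const_mul _ (Measurable.lintegral_prod_right (by fun_prop)),
            lintegral_lintegral_swap (by fun_prop)]
        simp_rw [h1]
        have hm : Measurable (Function.uncurry fun (x : E) (t : ℝ) =>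
            ∫⁻ y in Ω, g ((1 - t) • x + t • y) ∂μ) := by
          refine Measurable.lintegral_prod_right (f := fun (p : E × ℝ) (y : E) =>
            g ((1 - p.2) • p.1 + p.2 • y)) ?_
          fun_prop
        rw [lintegral_const_mul _ hm.lintegral_prod_right,
          lintegral_lintegral_swap hm.aemeasurable]
    _ ≤ Metric.ediam Ω ^ 2 * ∫⁻ t in Set.Ioc (0 : ℝ) 1,
          2 ^ Module.finrank ℝ E * μ Ω * ∫⁻ x in Ω, g x ∂μ := by
        refine mul_le_mul_right ?_ _
        exact setLIntegral_mono' measurableSet_Ioc fun t ht =>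
          lintegral_lintegral_segment_le μ hgm hΩ hc ⟨ht.1.le, ht.2⟩
    _ = _ := by simp [mul_assoc]

theorem sq_measure_mul_lintegral_enorm_sq_le {Ω V : Set E} (hΩ : MeasurableSet Ω)
    (hc : Convex ℝ Ω) (hVΩ : V ⊆ Ω) {v : E → ℝ}
    (hv : ContDiff ℝ 1 v) :
    μ V ^ 2 * ∫⁻ x in Ω, ‖v x‖ₑ ^ 2 ∂μ ≤
      2 * (μ V * (Metric.ediam Ω ^ 2 * (2 ^ Module.finrank ℝ E * μ Ω) *
        ∫⁻ x in Ω, ‖fderiv ℝ v x‖ₑ ^ 2 ∂μ) + (∫⁻ x in V, ‖v x‖ₑ ∂μ) ^ 2 * μ Ω) := by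
  have hvc : Continuous v := hv.continuous
  have hpt : ∀ x, μ V ^ 2 * ‖v x‖ₑ ^ 2 ≤
      2 * (μ V * ∫⁻ y in Ω, ‖v y - v x‖ₑ ^ 2 ∂μ + (∫⁻ y in V, ‖v y‖ₑ ∂μ) ^ 2) := by
    intro x
    have h1 : μ V * ‖v x‖ₑ ≤ ∫⁻ y in V, ‖v y - v x‖ₑ ∂μ + ∫⁻ y in V, ‖v y‖ₑ ∂μ := by
      rw [← lintegral_add_left (by fun_prop), mul_comm, ← setLIntegral_const]
      refine lintegral_mono fun y => ?_
      calc ‖v x‖ₑ = ‖(v x - v y) + v y‖ₑ := by simp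
        _ ≤ ‖v x - v y‖ₑ + ‖v y‖ₑ := enorm_add_le _ _
        _ = ‖v y - v x‖ₑ + ‖v y‖ₑ := by rw [enorm_sub_rev]
    rw [← mul_pow]
    refine (pow_le_pow_left' h1 2).trans ((ENNReal.add_sq_le_two_mul _ _).trans ?_)
    gcongr
    refine (sq_lintegral_le (μ.restrict V) (by fun_prop)).trans ?_
    rw [Measure.restrict_apply_univ]
    gcongr
  have hm : Measurable fun x => ∫⁻ y in Ω, ‖v y - v x‖ₑ ^ 2 ∂μ :=
    Measurable.lintegral_prod_right (f := fun x y => ‖v y - v x‖ₑ ^ 2) (by fun_prop)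
  calc μ V ^ 2 * ∫⁻ x in Ω, ‖v x‖ₑ ^ 2 ∂μ
      = ∫⁻ x in Ω, μ V ^ 2 * ‖v x‖ₑ ^ 2 ∂μ := by rw [lintegral_const_mul _ (by fun_prop)]
    _ ≤ ∫⁻ x in Ω, 2 * (μ V * ∫⁻ y in Ω, ‖v y - v x‖ₑ ^ 2 ∂μ +
          (∫⁻ y in V, ‖v y‖ₑ ∂μ) ^ 2) ∂μ := lintegral_mono hpt
    _ = 2 * (μ V * ∫⁻ x in Ω, ∫⁻ y in Ω, ‖v y - v x‖ₑ ^ 2 ∂μ ∂μ +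
          (∫⁻ y in V, ‖v y‖ₑ ∂μ) ^ 2 * μ Ω) := by
        rw [lintegral_const_mul _ (by fun_prop), lintegral_add_left (by fun_prop),
          lintegral_const_mul _ hm, setLIntegral_const]
    _ ≤ _ := by
        gcongr
        exact lintegral_lintegral_enorm_sub_sq_le μ hΩ hc hv

end Poincare

/-- Corollary 3.2 of the paper, a Poincaré-type inequality. For a nonempty
bounded convex open set `Ω ⊆ ℝⁿ` and `V₀ > 0` there is a constant `C > 0` such that for every
measurable `V ⊆ Ω` of measure at least `V₀` and every `C¹` function `v : ℝⁿ → ℝ`,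
the `H¹(Ω)`-norm of `v` is bounded by `C (‖∇v‖_{L²(Ω)} + ∫_V |v|)`. -/
theorem poincare_type_inequality {n : ℕ} (Ω : Set (EuclideanSpace ℝ (Fin n)))
    (hΩne : Ω.Nonempty) (hΩo : IsOpen Ω) (hΩb : Bornology.IsBounded Ω)
    (hΩc : Convex ℝ Ω) (V₀ : ℝ) (hV₀ : 0 < V₀) :
    ∃ C > (0:ℝ), ∀ V : Set (EuclideanSpace ℝ (Fin n)), MeasurableSet V → V ⊆ Ω →
      ENNReal.ofReal V₀ ≤ volume V →
      ∀ v : EuclideanSpace ℝ (Fin n) → ℝ, ContDiff ℝ 1 v →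
        Real.sqrt (∫ x in Ω, ((v x) ^ 2 + ‖fderiv ℝ v x‖ ^ 2)) ≤
          C * (Real.sqrt (∫ x in Ω, ‖fderiv ℝ v x‖ ^ 2) + ∫ x in V, |v x|) := by
  set d := Module.finrank ℝ (EuclideanSpace ℝ (Fin n))
  set K : ℝ := Metric.diam Ω ^ 2 * (2 ^ d * volume.real Ω) with hK
  have hK0 : 0 ≤ K := by positivity
  set a : ℝ := 2 * K / V₀
  set b : ℝ := 2 * volume.real Ω / V₀ ^ 2
  have ha : 0 ≤ a := by positivity
  have hb : 0 ≤ b := by positivity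
  refine ⟨1 + a + b, by positivity, fun V hV hVΩ hVm v hv => ?_⟩
  have hΩtop : volume Ω ≠ ⊤ := hΩb.measure_lt_top.ne
  have hVtop : volume V ≠ ⊤ := measure_ne_top_of_subset hVΩ hΩtop
  have hint : ∀ f : EuclideanSpace ℝ (Fin n) → ℝ, Continuous f → IntegrableOn f Ω :=
    fun f hf => (hf.continuousOn.integrableOn_compact hΩb.isCompact_closure).mono_set
      subset_closure
  have hvc := hv.continuous
  have hdc := hv.continuous_fderiv one_ne_zero
  set G := ∫ x in Ω, ‖fderiv ℝ v x‖ ^ 2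
  set I := ∫ x in Ω, v x ^ 2
  set A := ∫ x in V, |v x|
  set m := volume.real V
  have hm : V₀ ≤ m := (ENNReal.ofReal_le_iff_le_toReal hVtop).1 hVm
  have hG0 : 0 ≤ G := integral_nonneg fun _ => by positivity
  have hA0 : 0 ≤ A := integral_nonneg fun _ => by positivity
  have hI0 : 0 ≤ I := integral_nonneg fun _ => by positivity
  have hGe : ∫⁻ x in Ω, ‖fderiv ℝ v x‖ₑ ^ 2 = ENNReal.ofReal G := by
    rw [ofReal_integral_eq_lintegral_ofReal (hint _ (by fun_prop))
      (.of_forall fun _ => by positivity)]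
    simp [ENNReal.ofReal_pow]
  have hIe : ∫⁻ x in Ω, ‖v x‖ₑ ^ 2 = ENNReal.ofReal I := by
    rw [ofReal_integral_eq_lintegral_ofReal (hint _ (by fun_prop))
      (.of_forall fun _ => by positivity)]
    refine lintegral_congr fun x => ?_
    rw [← sq_abs, ENNReal.ofReal_pow (abs_nonneg _), Real.enorm_eq_ofReal_abs]
  have hAe : ∫⁻ x in V, ‖v x‖ₑ = ENNReal.ofReal A := by
    rw [ofReal_integral_eq_lintegral_ofReal ((hint _ (by fun_prop)).mono_set hVΩ)
      (.of_forall fun _ => by positivity)]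
    simp [Real.enorm_eq_ofReal_abs]
  have hmain : m ^ 2 * I ≤ 2 * (m * (K * G) + A ^ 2 * volume.real Ω) := by
    have h := sq_measure_mul_lintegral_enorm_sq_le volume hΩo.measurableSet hΩc hVΩ hv
    rw [hGe, hIe, hAe] at h
    have h' := ENNReal.toReal_mono (by
      have := hΩb.ediam_ne_top
      finiteness) h
    rw [ENNReal.toReal_mul, ENNReal.toReal_mul, ENNReal.toReal_add (by
      have := hΩb.ediam_ne_top
      finiteness) (by finiteness)] at h'
    simpa [hG0, hI0, hA0, hK, m, d, Metric.diam, Measure.real] using h'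
  have hm0 : 0 < m := hV₀.trans_le hm
  have hI : I ≤ a * G + b * A ^ 2 := by
    calc I ≤ 2 * K / m * G + 2 * volume.real Ω / m ^ 2 * A ^ 2 := by
          rw [← mul_le_mul_iff_right₀ (pow_pos hm0 2)]
          refine hmain.trans_eq ?_
          field_simp
      _ ≤ _ := by
          simp only [a, b]
          gcongr
  rw [integral_add (hint _ (by fun_prop)) (hint _ (by fun_prop))]
  refine Real.sqrt_le_iff.2 ⟨by positivity, ?_⟩
  have hs := Real.sq_sqrt hG0
  set s := √G
  have hs0 : 0 ≤ s := Real.sqrt_nonneg _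
  calc I + G ≤ (1 + a) * s ^ 2 + b * A ^ 2 := by rw [hs]; linarith
    _ ≤ (1 + a + b) ^ 2 * s ^ 2 + (1 + a + b) ^ 2 * A ^ 2 := by
        gcongr <;> nlinarith [mul_nonneg ha hb]
    _ ≤ ((1 + a + b) * (s + A)) ^ 2 := by
        have : 0 ≤ (1 + a + b) ^ 2 * (s * A) := by positivity
        nlinarith
end

section
/- Let a, b > 0 and ν ∈ [0,1]. Then S(a/b)·a^{1−ν}·b^{ν} ≥ (1−ν)·a + ν·b, where S denotes the Specht ratio. -/
open Real

/-- The Specht ratio `S(h) = h^(1/(h−1)) / (e · log h^(1/(h−1)))` for `h > 0, h ≠ 1`,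
with `S(1) = 1`. -/
noncomputable def spechtRatio (h : ℝ) : ℝ :=
  if h = 1 then 1
  else h ^ ((1:ℝ) / (h - 1)) / (Real.exp 1 * Real.log (h ^ ((1:ℝ) / (h - 1))))

lemma log_div_sub_one_pos {h : ℝ} (h0 : 0 < h) (h1 : h ≠ 1) : 0 < Real.log h / (h - 1) := by
  rcases lt_or_gt_of_ne h1 with hlt | hgt
  · exact div_pos_of_neg_of_neg (Real.log_neg h0 hlt) (sub_neg.2 hlt)
  · exact div_pos (Real.log_pos hgt) (sub_pos.2 hgt)

lemma spechtRatio_eq_exp {h : ℝ} (h0 : 0 < h) (h1 : h ≠ 1) :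
    spechtRatio h =
      Real.exp (Real.log h / (h - 1) - 1) / (Real.log h / (h - 1)) := by
  have hpow : h ^ ((1 : ℝ) / (h - 1)) = Real.exp (Real.log h / (h - 1)) := by
    rw [Real.rpow_def_of_pos h0, mul_one_div]
  rw [spechtRatio, if_neg h1, hpow, Real.log_exp, Real.exp_sub, div_div]

/-- The reverse Young inequality normalised to `b = 1`, valid for every real weight. -/
lemma one_add_mul_sub_one_le_spechtRatio_mul_rpow {h : ℝ} (h0 : 0 < h) (t : ℝ) :
    1 + t * (h - 1) ≤ spechtRatio h * h ^ t := by
  by_cases h1 : h = 1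
  · simp [h1, spechtRatio]
  have hc := log_div_sub_one_pos h0 h1
  have hlog : Real.log h = Real.log h / (h - 1) * (h - 1) :=
    (div_mul_cancel₀ _ (sub_ne_zero.2 h1)).symm
  rw [spechtRatio_eq_exp h0 h1, Real.rpow_def_of_pos h0]
  set c := Real.log h / (h - 1)
  rw [hlog, div_mul_eq_mul_div, ← Real.exp_add, le_div_iff₀ hc]
  have hexp := Real.add_one_le_exp (c - 1 + c * (h - 1) * t)
  linarith

/-- reverse Young inequality, Theorem A.2 of the paper's appendix.
For `a, b > 0` and `ν ∈ [0,1]`, `S(a/b)·a^(1−ν)·b^ν ≥ (1−ν)a + νb`. -/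
theorem reverse_young_inequality (a b : ℝ) (ha : 0 < a) (hb : 0 < b)
    (ν : ℝ) (hν : ν ∈ Set.Icc (0:ℝ) 1) :
    (1 - ν) * a + ν * b ≤ spechtRatio (a / b) * a ^ (1 - ν) * b ^ ν := by
  have hab := one_add_mul_sub_one_le_spechtRatio_mul_rpow (div_pos ha hb) (1 - ν)
  have hpow : (a / b) ^ (1 - ν) * b = a ^ (1 - ν) * b ^ ν := by
    rw [Real.div_rpow ha.le hb.le, Real.rpow_sub hb, Real.rpow_one]
    field_simp
  calc (1 - ν) * a + ν * b = (1 + (1 - ν) * (a / b - 1)) * b := by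
        field_simp
        ring
    _ ≤ spechtRatio (a / b) * (a / b) ^ (1 - ν) * b :=
        mul_le_mul_of_nonneg_right hab hb.le
    _ = spechtRatio (a / b) * a ^ (1 - ν) * b ^ ν := by
        rw [mul_assoc, hpow, mul_assoc]
end

section
/- Let a, b > 0. Then a² + b² ≤ 4·S(a/b)²·a·b, where S denotes the Specht ratio. -/
open Real

/-- The Specht ratio bounds the ratio of the arithmetic to the geometric mean of `h` and `1`. -/
lemma sq_add_one_le_four_mul_spechtRatio_sq_mul {h : ℝ} (hh : 0 < h) :
    (h + 1) ^ 2 ≤ 4 * spechtRatio h ^ 2 * h := by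
  by_cases h1 : h = 1
  · norm_num [spechtRatio, h1]
  have hne : h - 1 ≠ 0 := sub_ne_zero.mpr h1
  set u : ℝ := log h / (h - 1) with hu
  have hlog : u * (h - 1) = log h := div_mul_cancel₀ _ hne
  have hupos : 0 < u := by
    rcases lt_or_gt_of_ne h1 with hlt | hgt
    · exact div_pos_of_neg_of_neg (log_neg hh hlt) (sub_neg.mpr hlt)
    · exact div_pos (log_pos hgt) (sub_pos.mpr hgt)
  have hS : spechtRatio h = exp (u - 1) / u := by
    have hpow : h ^ ((1:ℝ) / (h - 1)) = exp u := by
      rw [rpow_def_of_pos hh, hu, mul_one_div]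
    rw [spechtRatio, if_neg h1, hpow, log_exp, exp_sub, div_div]
  have hexp : u * (h + 1) / 2 ≤ exp (u - 1) * exp (log h / 2) := by
    have key := add_one_le_exp (u * (h + 1) / 2 - 1)
    have harg : u * (h + 1) / 2 - 1 = (u - 1) + log h / 2 := by rw [← hlog]; ring
    rwa [sub_add_cancel, harg, exp_add] at key
  have hmean : h + 1 ≤ 2 * spechtRatio h * exp (log h / 2) := by
    have hcancel : 2 * spechtRatio h * exp (log h / 2) =
        2 * (exp (u - 1) * exp (log h / 2)) / u := by rw [hS]; ring
    rw [hcancel, le_div_iff₀ hupos]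
    linarith
  have hsqrt : exp (log h / 2) ^ 2 = h := by
    rw [← exp_nat_mul, Nat.cast_ofNat, mul_div_cancel₀ _ two_ne_zero, exp_log hh]
  calc (h + 1) ^ 2 ≤ (2 * spechtRatio h * exp (log h / 2)) ^ 2 := by gcongr
    _ = 4 * spechtRatio h ^ 2 * exp (log h / 2) ^ 2 := by ring
    _ = 4 * spechtRatio h ^ 2 * h := by rw [hsqrt]

/-- the reverse Young inequality at `ν = 1/2`, as used in the paper's
δ-limit: for `a, b > 0`, `a² + b² ≤ 4·S(a/b)²·a·b`. -/
theorem reverse_young_half (a b : ℝ) (ha : 0 < a) (hb : 0 < b) :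
    a ^ 2 + b ^ 2 ≤ 4 * spechtRatio (a / b) ^ 2 * a * b := by
  have hmean := sq_add_one_le_four_mul_spechtRatio_sq_mul (div_pos ha hb)
  calc a ^ 2 + b ^ 2 ≤ (a + b) ^ 2 := by nlinarith [mul_pos ha hb]
    _ = (a / b + 1) ^ 2 * b ^ 2 := by field_simp
    _ ≤ 4 * spechtRatio (a / b) ^ 2 * (a / b) * b ^ 2 := by gcongr
    _ = 4 * spechtRatio (a / b) ^ 2 * (a / b * b) * b := by ring
    _ = 4 * spechtRatio (a / b) ^ 2 * a * b := by rw [div_mul_cancel₀ a hb.ne']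
end

section
/- Let (Ω, 𝓕, μ) be a probability measure space, let 0 < m < M, let p ≥ 1, and let f : Ω → ℝ be measurable with m ≤ f(x) ≤ M for μ-almost every x. Set a = (M^p − m^p)/(M − m), b = (M·m^p − m·M^p)/(M − m), and for any x₀ with m < x₀ < M set α = a/(p·x₀^{p−1}) and β = a·(1 − 1/p)·x₀ + b. Then ∫ f^p dμ ≤ α·(∫ f dμ)^p + β. -/
open Real MeasureTheory

/-- On `[m, M]` the function `t ↦ t ^ p` lies below its chord. -/
theorem rpow_le_chord {m M p t : ℝ} (hm : 0 ≤ m) (hmM : m < M) (hp : 1 ≤ p)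
    (hmt : m ≤ t) (htM : t ≤ M) :
    t ^ p ≤ (M ^ p - m ^ p) / (M - m) * t + (M * m ^ p - m * M ^ p) / (M - m) := by
  have hd : 0 < M - m := sub_pos.2 hmM
  have h := (convexOn_rpow hp).2 (Set.mem_Ici.2 hm) (Set.mem_Ici.2 (hm.trans hmM.le))
    (div_nonneg (sub_nonneg.2 htM) hd.le) (div_nonneg (sub_nonneg.2 hmt) hd.le)
    (by field_simp; ring)
  simp only [smul_eq_mul] at h
  have ht : (M - t) / (M - m) * m + (t - m) / (M - m) * M = t := by
    field_simp
    ring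
  rw [ht] at h
  refine h.trans_eq ?_
  field_simp
  ring

/-- The function `t ↦ t ^ p` lies above its tangent line at `x₀ > 0`. -/
theorem tangent_le_rpow {x₀ p t : ℝ} (hx₀ : 0 < x₀) (hp : 1 ≤ p) (ht : 0 ≤ t) :
    x₀ ^ (p - 1) * (x₀ + p * (t - x₀)) ≤ t ^ p := by
  have hs : -1 ≤ t / x₀ - 1 := by linarith [div_nonneg ht hx₀.le]
  have h := one_add_mul_self_le_rpow_one_add hs hp
  rw [add_sub_cancel, div_rpow ht hx₀.le, le_div_iff₀ (rpow_pos_of_pos hx₀ p)] at h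
  refine le_trans (le_of_eq ?_) h
  rw [rpow_sub_one hx₀.ne']
  field_simp

/-- inverse Jensen inequality, Theorem A.4 of the paper's appendix.
On a probability space, for measurable `f` with `m ≤ f ≤ M` a.e. (`0 < m < M`) and `p ≥ 1`,
with `a = (Mᵖ − mᵖ)/(M − m)`, `b = (M·mᵖ − m·Mᵖ)/(M − m)`, and for any `m < x₀ < M`,
`α = a/(p·x₀^(p−1))`, `β = a(1 − 1/p)x₀ + b`, one has `∫ fᵖ ≤ α (∫ f)ᵖ + β`. -/
theorem inverse_jensen_inequality {Ω : Type*} [MeasurableSpace Ω]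
    (μ : Measure Ω) [IsProbabilityMeasure μ]
    (m M : ℝ) (hm : 0 < m) (hmM : m < M) (p : ℝ) (hp : 1 ≤ p)
    (f : Ω → ℝ) (hf : Measurable f)
    (hbound : ∀ᵐ x ∂μ, m ≤ f x ∧ f x ≤ M)
    (x₀ : ℝ) (hx₀m : m < x₀) (hx₀M : x₀ < M) :
    ∫ x, (f x) ^ p ∂μ ≤
      ((M ^ p - m ^ p) / (M - m)) / (p * x₀ ^ (p - 1)) * (∫ x, f x ∂μ) ^ p
        + (((M ^ p - m ^ p) / (M - m)) * (1 - 1 / p) * x₀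
            + (M * m ^ p - m * M ^ p) / (M - m)) := by
  have hx₀ : 0 < x₀ := hm.trans hx₀m
  have hp₀ : 0 < p := zero_lt_one.trans_le hp
  have hint : Integrable f μ :=
    .of_mem_Icc m M hf.aemeasurable hbound
  have hintp : Integrable (fun x ↦ f x ^ p) μ := by
    refine .of_mem_Icc (m ^ p) (M ^ p) (hf.pow_const p).aemeasurable ?_
    filter_upwards [hbound] with x hx
    exact ⟨rpow_le_rpow hm.le hx.1 hp₀.le, rpow_le_rpow (hm.le.trans hx.1) hx.2 hp₀.le⟩
  have hmean : 0 ≤ ∫ x, f x ∂μ :=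
    integral_nonneg_of_ae (hbound.mono fun x hx ↦ hm.le.trans hx.1)
  have htangent := tangent_le_rpow hx₀ hp hmean
  have ha : 0 ≤ (M ^ p - m ^ p) / (M - m) :=
    div_nonneg (sub_nonneg.2 (rpow_le_rpow hm.le hmM.le hp₀.le)) (sub_pos.2 hmM).le
  have hchord : ∫ x, f x ^ p ∂μ ≤
      (M ^ p - m ^ p) / (M - m) * ∫ x, f x ∂μ + (M * m ^ p - m * M ^ p) / (M - m) := by
    calc ∫ x, f x ^ p ∂μ
        ≤ ∫ x, ((M ^ p - m ^ p) / (M - m) * f x + (M * m ^ p - m * M ^ p) / (M - m)) ∂μ :=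
          integral_mono_ae hintp ((hint.const_mul _).add (integrable_const _))
            (hbound.mono fun x hx ↦ rpow_le_chord hm.le hmM hp hx.1 hx.2)
      _ = _ := by
          rw [integral_add (hint.const_mul _) (integrable_const _), integral_const_mul]
          simp
  generalize (M ^ p - m ^ p) / (M - m) = a at *
  generalize (M * m ^ p - m * M ^ p) / (M - m) = b at *
  have hc : 0 < x₀ ^ (p - 1) := rpow_pos_of_pos hx₀ _
  calc ∫ x, f x ^ p ∂μ
      ≤ a * ∫ x, f x ∂μ + b := hchord
    _ = a / (p * x₀ ^ (p - 1)) * (x₀ ^ (p - 1) * (x₀ + p * (∫ x, f x ∂μ - x₀)))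
          + (a * (1 - 1 / p) * x₀ + b) := by
        field_simp
        ring
    _ ≤ _ := by gcongr
end

section
/- Let ρ, θ : ℝ × ℝⁿ → (0,∞) with ρ continuously differentiable and twice continuously differentiable in the spatial variable, θ continuously differentiable, let u : ℝ × ℝⁿ → ℝⁿ be continuously differentiable, let ε ∈ ℝ, and suppose the regularized continuity equation ∂_t ρ + div_x(ρ u) = ε·Δ_x ρ holds at every (t,x). Then at every (t,x) the identity −∂_t[ρ(log ρ − log θ − 1)] − div_x[ρ(log ρ − log θ − 1)·u] = ε·(log θ − log ρ − 1)·Δ_x ρ + ρ·div_x u + (1/θ)·(∂_t(ρθ) + div_x(ρθ·u)) holds. -/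
open Real

/-- Partial derivative in the time variable of `f : ℝ × ℝⁿ → ℝ`. -/
noncomputable def pderivT {n : ℕ} (f : ℝ × (Fin n → ℝ) → ℝ) (q : ℝ × (Fin n → ℝ)) : ℝ :=
  deriv (fun t => f (t, q.2)) q.1

/-- Partial derivative in the `i`-th spatial variable of `f : ℝ × ℝⁿ → ℝ`. -/
noncomputable def pderivX {n : ℕ} (i : Fin n) (f : ℝ × (Fin n → ℝ) → ℝ)
    (q : ℝ × (Fin n → ℝ)) : ℝ :=
  deriv (fun s => f (q.1, Function.update q.2 i s)) (q.2 i)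

/-- Spatial divergence `div_x w = Σᵢ ∂_{xᵢ} wᵢ` of a vector field `w : ℝ × ℝⁿ → ℝⁿ`. -/
noncomputable def divX {n : ℕ} (w : ℝ × (Fin n → ℝ) → (Fin n → ℝ))
    (q : ℝ × (Fin n → ℝ)) : ℝ :=
  ∑ i, pderivX i (fun q' => w q' i) q

/-- Spatial Laplacian `Δ_x f = Σᵢ ∂²_{xᵢ} f` of `f : ℝ × ℝⁿ → ℝ`. -/
noncomputable def lapX {n : ℕ} (f : ℝ × (Fin n → ℝ) → ℝ) (q : ℝ × (Fin n → ℝ)) : ℝ :=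
  ∑ i, pderivX i (pderivX i f) q

/-- One-dimensional entropy product rule: the flux of `r (log r - log h - 1)` expressed through
the fluxes of `r` and `r h`. -/
lemma deriv_entropy_flux {r h v : ℝ → ℝ} {a : ℝ} (hr : DifferentiableAt ℝ r a)
    (hh : DifferentiableAt ℝ h a) (hv : DifferentiableAt ℝ v a) (hr0 : r a ≠ 0) (hh0 : h a ≠ 0) :
    deriv (fun s => r s * (Real.log (r s) - Real.log (h s) - 1) * v s) a
      = (Real.log (r a) - Real.log (h a) + 1) * deriv (fun s => r s * v s) a
        - r a * deriv v a - (1 / h a) * deriv (fun s => r s * h s * v s) a := by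
  have hr' := hr.hasDerivAt
  have hh' := hh.hasDerivAt
  have hv' := hv.hasDerivAt
  have h1 := (hr'.fun_mul (((hr'.log hr0).fun_sub (hh'.log hh0)).sub_const 1)).fun_mul hv'
  have h2 := hr'.fun_mul hv'
  have h3 := (hr'.fun_mul hh').fun_mul hv'
  rw [h1.deriv, h2.deriv, h3.deriv]
  field_simp
  ring

lemma pderivX_entropy_flux {n : ℕ} {ρ θ v : ℝ × (Fin n → ℝ) → ℝ} (hρ : Differentiable ℝ ρ)
    (hθ : Differentiable ℝ θ) (hv : Differentiable ℝ v) (i : Fin n) (q : ℝ × (Fin n → ℝ))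
    (hρ0 : ρ q ≠ 0) (hθ0 : θ q ≠ 0) :
    pderivX i (fun q' => ρ q' * (Real.log (ρ q') - Real.log (θ q') - 1) * v q') q
      = (Real.log (ρ q) - Real.log (θ q) + 1) * pderivX i (fun q' => ρ q' * v q') q
        - ρ q * pderivX i v q - (1 / θ q) * pderivX i (fun q' => ρ q' * θ q' * v q') q := by
  have hline : Differentiable ℝ (fun s : ℝ => (q.1, Function.update q.2 i s)) :=
    (differentiable_const _).prodMk fun s => (hasDerivAt_update q.2 i s).differentiableAt
  have hq : (q.1, Function.update q.2 i (q.2 i)) = q := by simp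
  have key := deriv_entropy_flux (a := q.2 i) (hρ.comp hline _) (hθ.comp hline _)
    (hv.comp hline _) (by simpa using hρ0) (by simpa using hθ0)
  simpa only [pderivX, Function.comp_def, hq] using key

lemma pderivT_entropy {n : ℕ} {ρ θ : ℝ × (Fin n → ℝ) → ℝ} (hρ : Differentiable ℝ ρ)
    (hθ : Differentiable ℝ θ) (q : ℝ × (Fin n → ℝ)) (hρ0 : ρ q ≠ 0) (hθ0 : θ q ≠ 0) :
    pderivT (fun q' => ρ q' * (Real.log (ρ q') - Real.log (θ q') - 1)) q
      = (Real.log (ρ q) - Real.log (θ q) + 1) * pderivT ρ q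
        - (1 / θ q) * pderivT (fun q' => ρ q' * θ q') q := by
  have hline : Differentiable ℝ (fun t : ℝ => (t, q.2)) :=
    differentiable_id.prodMk (differentiable_const _)
  have key := deriv_entropy_flux (a := q.1) (hρ.comp hline _) (hθ.comp hline _)
    (differentiableAt_const 1) hρ0 hθ0
  simpa only [pderivT, Function.comp_def, mul_one, deriv_const, mul_zero, sub_zero] using key

lemma divX_entropy_flux {n : ℕ} {ρ θ : ℝ × (Fin n → ℝ) → ℝ} {u : ℝ × (Fin n → ℝ) → (Fin n → ℝ)}
    (hρ : Differentiable ℝ ρ) (hθ : Differentiable ℝ θ) (hu : Differentiable ℝ u)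
    (q : ℝ × (Fin n → ℝ)) (hρ0 : ρ q ≠ 0) (hθ0 : θ q ≠ 0) :
    divX (fun q' i => ρ q' * (Real.log (ρ q') - Real.log (θ q') - 1) * u q' i) q
      = (Real.log (ρ q) - Real.log (θ q) + 1) * divX (fun q' i => ρ q' * u q' i) q
        - ρ q * divX u q - (1 / θ q) * divX (fun q' i => ρ q' * θ q' * u q' i) q := by
  simp only [divX, Finset.mul_sum, ← Finset.sum_sub_distrib]
  exact Finset.sum_congr rfl fun i _ =>
    pderivX_entropy_flux hρ hθ (differentiable_pi.1 hu i) i q hρ0 hθ0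

/-- Section 4.3 of the paper: from internal energy balance to entropy
balance. If the regularized continuity equation `∂_t ρ + div_x(ρu) = εΔ_x ρ` holds
pointwise, then the identity
`−∂_t[ρ(log ρ − log θ − 1)] − div_x[ρ(log ρ − log θ − 1)u]
  = ε(log θ − log ρ − 1)Δ_x ρ + ρ div_x u + (1/θ)(∂_t(ρθ) + div_x(ρθ u))`
holds pointwise. -/
theorem entropy_energy_identity {n : ℕ}
    (ρ θ : ℝ × (Fin n → ℝ) → ℝ) (u : ℝ × (Fin n → ℝ) → (Fin n → ℝ))
    (hρpos : ∀ q, 0 < ρ q) (hθpos : ∀ q, 0 < θ q)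
    (hρ : ContDiff ℝ 1 ρ) (hρ2 : ∀ t, ContDiff ℝ 2 (fun x => ρ (t, x)))
    (hθ : ContDiff ℝ 1 θ) (hu : ContDiff ℝ 1 u) (ε : ℝ)
    (heq : ∀ q, pderivT ρ q + divX (fun q' i => ρ q' * u q' i) q = ε * lapX ρ q) :
    ∀ q, -(pderivT (fun q' => ρ q' * (Real.log (ρ q') - Real.log (θ q') - 1)) q)
        - divX (fun q' i => ρ q' * (Real.log (ρ q') - Real.log (θ q') - 1) * u q' i) q
      = ε * (Real.log (θ q) - Real.log (ρ q) - 1) * lapX ρ q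
        + ρ q * divX u q
        + (1 / θ q) * (pderivT (fun q' => ρ q' * θ q') q
            + divX (fun q' i => ρ q' * θ q' * u q' i) q) := by
  intro q
  have hρd := hρ.differentiable one_ne_zero
  have hθd := hθ.differentiable one_ne_zero
  have hud := hu.differentiable one_ne_zero
  rw [pderivT_entropy hρd hθd q (hρpos q).ne' (hθpos q).ne',
    divX_entropy_flux hρd hθd hud q (hρpos q).ne' (hθpos q).ne']
  linear_combination (-(Real.log (ρ q) - Real.log (θ q) + 1)) * heq q
end
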